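/- Consider the BB84 ensemble of four qubit states ρ_{1,±} = ½(I ± σz), ρ_{2,±} = ½(I ± σx) with uniform prior 1/4, partitioned by basis into X_1 = {(1,+),(1,−)}, X_2 = {(2,+),(2,−)}; the average state is ρ = I/2. Then: (a) the maximum confidence without side information is ½, i.e., for every effect E with 0 ≤ E ≤ I and tr(E) > 0, (¼ tr(ρ_{j,p} E)) / tr((I/2)E) ≤ ½, with equality when E = ρ_{j,p}; (b) for the measurement N(j,p) = ½ ρ_{j,p} (a POVM), given basis side information j, each outcome (j,p) identifies the state with confidence 1: (¼ tr(ρ_{j,p} N(j,p))) / (½ tr(ρ_j N(j,p))) = 1, where ρ_j = ½(ρ_{j,+} + ρ_{j,−}) = I/2; and (c) the conclusive rate is ∑_{j=1}^2 ½ tr(ρ_j (N(j,+) + N(j,−))) = ½. -/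

import Mathlib

open Matrix
open scoped ComplexOrder

noncomputable section

def σx : Matrix (Fin 2) (Fin 2) ℂ := !![0, 1; 1, 0]
def σz : Matrix (Fin 2) (Fin 2) ℂ := !![1, 0; 0, -1]

/-- Sign of a parity bit: `true ↦ +1`, `false ↦ -1`. -/
def sgn (b : Bool) : ℝ := if b then 1 else -1

/-- The BB84 states `ρ_{1,±} = ½(I ± σz)` and `ρ_{2,±} = ½(I ± σx)`
(basis index `0 ↦ z`, `1 ↦ x`). -/
def bb84 (j : Fin 2) (p : Bool) : Matrix (Fin 2) (Fin 2) ℂ :=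
  if j = 0 then (1 / 2 : ℝ) • ((1 : Matrix (Fin 2) (Fin 2) ℂ) + sgn p • σz)
  else (1 / 2 : ℝ) • ((1 : Matrix (Fin 2) (Fin 2) ℂ) + sgn p • σx)

/-- The average state of each basis part, `ρ_j = ½(ρ_{j,+} + ρ_{j,-})`. -/
def bb84Part (j : Fin 2) : Matrix (Fin 2) (Fin 2) ℂ :=
  (1 / 2 : ℝ) • (bb84 j true + bb84 j false)

/-- The maximum-confidence measurement `N(j,p) = ½ ρ_{j,p}`. -/
def bb84Mcm (j : Fin 2) (p : Bool) : Matrix (Fin 2) (Fin 2) ℂ :=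
  (1 / 2 : ℝ) • bb84 j p

lemma bb84_isHermitian (j : Fin 2) (p : Bool) : (bb84 j p).IsHermitian := by
  ext a b
  fin_cases j <;> cases p <;> fin_cases a <;> fin_cases b <;>
    simp [bb84, sgn, σx, σz]

lemma bb84_mul_self (j : Fin 2) (p : Bool) : bb84 j p * bb84 j p = bb84 j p := by
  ext a b
  fin_cases j <;> cases p <;> fin_cases a <;> fin_cases b <;>
    simp [bb84, sgn, σx, σz, Matrix.mul_apply] <;> norm_num

lemma bb84_trace (j : Fin 2) (p : Bool) : (bb84 j p).trace = 1 := by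
  fin_cases j <;> cases p <;> simp [bb84, sgn, σx, σz, Matrix.trace_fin_two]

lemma bb84_add_bb84_not (j : Fin 2) (p : Bool) : bb84 j p + bb84 j (!p) = 1 := by
  fin_cases j <;> cases p <;> simp only [bb84, sgn] <;> simp <;> module

lemma bb84Part_eq (j : Fin 2) : bb84Part j = (1 / 2 : ℝ) • (1 : Matrix (Fin 2) (Fin 2) ℂ) := by
  rw [bb84Part]
  exact congrArg _ (bb84_add_bb84_not j true)

lemma bb84Mcm_add (j : Fin 2) :
    bb84Mcm j true + bb84Mcm j false = (1 / 2 : ℝ) • (1 : Matrix (Fin 2) (Fin 2) ℂ) := by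
  rw [bb84Mcm, bb84Mcm, ← smul_add]
  exact congrArg _ (bb84_add_bb84_not j true)

lemma trace_bb84_mul_nonneg (j : Fin 2) (p : Bool) {E : Matrix (Fin 2) (Fin 2) ℂ}
    (hE : E.PosSemidef) : 0 ≤ ((bb84 j p * E).trace).re := by
  have h := (hE.mul_mul_conjTranspose_same (bb84 j p)).trace_nonneg
  rw [(bb84_isHermitian j p).eq, Matrix.trace_mul_comm, ← mul_assoc, bb84_mul_self] at h
  exact (Complex.le_def.1 h).1

lemma trace_bb84_mul_le (j : Fin 2) (p : Bool) {E : Matrix (Fin 2) (Fin 2) ℂ}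
    (hE : E.PosSemidef) : ((bb84 j p * E).trace).re ≤ E.trace.re := by
  have h : (bb84 j p * E).trace + (bb84 j (!p) * E).trace = E.trace := by
    rw [← Matrix.trace_add, ← add_mul, bb84_add_bb84_not, one_mul]
  rw [← h, Complex.add_re]
  linarith [trace_bb84_mul_nonneg j (!p) hE]

/-- For the BB84 ensemble with uniform prior `1/4` and basis partition:
(a) the confidence of any effect `E` (with `0 ≤ E ≤ I`, `tr((I/2)E) > 0`) for any symbol is at
most `½`, with equality when `E = ρ_{j,p}`;
(b) `N(j,p) = ½ ρ_{j,p}` is a POVM and, given basis side information `j`, each outcome `(j,p)`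
identifies the state with confidence `1`;
(c) the conclusive rate of `N` with respect to the basis partition is `½`. -/
theorem bb84_confidence_and_conclusive_rate :
    (∀ (j : Fin 2) (p : Bool) (E : Matrix (Fin 2) (Fin 2) ℂ),
        E.PosSemidef → ((1 : Matrix (Fin 2) (Fin 2) ℂ) - E).PosSemidef →
        0 < ((((1 / 2 : ℝ) • (1 : Matrix (Fin 2) (Fin 2) ℂ)) * E).trace).re →
        ((1 / 4 : ℝ) * ((bb84 j p * E).trace).re) /
            ((((1 / 2 : ℝ) • (1 : Matrix (Fin 2) (Fin 2) ℂ)) * E).trace).re ≤ 1 / 2) ∧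
    (∀ (j : Fin 2) (p : Bool),
        ((1 / 4 : ℝ) * ((bb84 j p * bb84 j p).trace).re) /
            ((((1 / 2 : ℝ) • (1 : Matrix (Fin 2) (Fin 2) ℂ)) * bb84 j p).trace).re = 1 / 2) ∧
    (∑ j : Fin 2, ∑ p : Bool, bb84Mcm j p = 1) ∧
    (∀ (j : Fin 2) (p : Bool),
        ((1 / 4 : ℝ) * ((bb84 j p * bb84Mcm j p).trace).re) /
            ((1 / 2 : ℝ) * ((bb84Part j * bb84Mcm j p).trace).re) = 1) ∧
    (∑ j : Fin 2, (1 / 2 : ℝ) *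
        ((bb84Part j * (bb84Mcm j true + bb84Mcm j false)).trace).re = 1 / 2) := by
  refine ⟨fun j p E hE _ hpos => ?_, fun j p => ?_, ?_, fun j p => ?_, ?_⟩
  · rw [div_le_iff₀ hpos, smul_mul_assoc, one_mul, Matrix.trace_smul, Complex.smul_re, smul_eq_mul]
    linarith [trace_bb84_mul_le j p hE]
  · rw [bb84_mul_self, smul_mul_assoc, one_mul, Matrix.trace_smul, bb84_trace]
    norm_num
  · simp only [Fintype.sum_bool, bb84Mcm_add, Fin.sum_univ_two]
    module
  · rw [bb84Part_eq, bb84Mcm, mul_smul_comm, bb84_mul_self, smul_mul_assoc, one_mul]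
    simp only [Matrix.trace_smul, bb84_trace]
    norm_num
  · simp only [bb84Part_eq, bb84Mcm_add, Fin.sum_univ_two, smul_mul_assoc, one_mul,
      Matrix.trace_smul, Matrix.trace_one]
    norm_num
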